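/- Let T be a forest on n vertices. Then 𝓈(T) = ⌊3n/2⌋ if and only if T contains a spanning forest F such that: if n is even, every vertex of F has degree 1 or 3; and if n is odd, there is one vertex of F whose degree is 0 or 6 and every other vertex of F has degree 1 or 3. -/

import Mathlib

/-! Definitions for the slow coloring game (sum-color cost), paintability,
connectivity and auxiliary graphs. -/

variable {V : Type*}

/-- `D` is a maximal independent subset of `M` with respect to `G`:
`D ⊆ M`, `D` is independent in `G`, and every vertex of `M \ D` has a neighbor in `D`. -/
def SimpleGraph.MaxIndepSubset (G : SimpleGraph V) (M D : Finset V) : Prop :=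
  D ⊆ M ∧ (∀ u ∈ D, ∀ v ∈ D, ¬ G.Adj u v) ∧ ∀ v ∈ M, v ∉ D → ∃ u ∈ D, G.Adj u v

/-- Fueled recursion computing the slow coloring number of the subgraph of `G`
induced on the vertex set `A`.  In each round Lister marks a nonempty `M ⊆ A`,
scoring `|M|`, and Painter deletes a maximal independent subset `D` of `M`
(such a `D` is necessarily nonempty, so the game ends within `A.card` rounds;
hence the value is correct whenever the fuel is at least `A.card`). -/
noncomputable def SimpleGraph.slowAux [DecidableEq V] (G : SimpleGraph V) :
    ℕ → Finset V → ℕ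
  | 0, _ => 0
  | fuel + 1, A =>
    (A.powerset.filter fun M => M.Nonempty).sup fun M =>
      M.card + sInf {m | ∃ D : Finset V, G.MaxIndepSubset M D ∧ m = G.slowAux fuel (A \ D)}

/-- The slow coloring number (sum-color cost) `𝓈(G)` of a finite simple graph `G`. -/
noncomputable def SimpleGraph.sumColorCost [Fintype V] [DecidableEq V]
    (G : SimpleGraph V) : ℕ :=
  G.slowAux (Fintype.card V) Finset.univ

/-- `G` is `m`-connected: it has more than `m` vertices and deleting any set of
fewer than `m` vertices leaves a connected graph. -/
def SimpleGraph.MConnected [Fintype V] [DecidableEq V] (G : SimpleGraph V) (m : ℕ) : Prop :=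
  m < Fintype.card V ∧
    ∀ S : Finset V, S.card < m →
      (G.induce ((Finset.univ \ S : Finset V) : Set V)).Connected

/-- The independence number `α(G)`: the maximum size of a set of pairwise
nonadjacent vertices. -/
noncomputable def SimpleGraph.indepNumber (G : SimpleGraph V) : ℕ :=
  sSup {n | ∃ s : Set V, (∀ u ∈ s, ∀ v ∈ s, ¬ G.Adj u v) ∧ s.ncard = n}

/-- Fueled recursion for the `f`-painting game of `G` restricted to the vertex
set `A`: the empty graph is `f`-paintable, and a nonempty graph is `f`-paintable
iff every vertex has at least one token and, for every nonempty marked set `M`,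
Painter can delete some maximal independent subset `D` of `M` so that the rest
is paintable after each vertex of `M \ D` loses a token. -/
def SimpleGraph.paintAux [DecidableEq V] (G : SimpleGraph V) :
    ℕ → Finset V → (V → ℕ) → Prop
  | 0, A, _ => A = ∅
  | fuel + 1, A, f =>
    A = ∅ ∨ ((∀ v ∈ A, 1 ≤ f v) ∧
      ∀ M ⊆ A, M.Nonempty → ∃ D : Finset V, G.MaxIndepSubset M D ∧
        G.paintAux fuel (A \ D) (fun v => if v ∈ M \ D then f v - 1 else f v))

/-- `G` is `f`-paintable. -/
def SimpleGraph.Paintable [Fintype V] [DecidableEq V] (G : SimpleGraph V) (f : V → ℕ) : Prop :=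
  G.paintAux (Fintype.card V) Finset.univ f

/-- The sum-paintability `χ_SP(G)`: the least total number of tokens `∑ v, f v`
over functions `f` for which `G` is `f`-paintable. -/
noncomputable def SimpleGraph.sumPaintability [Fintype V] [DecidableEq V]
    (G : SimpleGraph V) : ℕ :=
  sInf {s | ∃ f : V → ℕ, G.Paintable f ∧ s = ∑ v, f v}

/-- The triangular prism graph on vertices `0,…,5` (a triangle `0,1,2`, a
triangle `3,4,5`, and the matching `03, 14, 25`). -/
def prismGraph : SimpleGraph (Fin 6) :=
  SimpleGraph.fromRel fun u v =>
    ((u : ℕ), (v : ℕ)) ∈ [(0,1), (1,2), (0,2), (3,4), (4,5), (3,5), (0,3), (1,4), (2,5)]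

/-- The star `K_{1,n-1}` on `n` vertices, with center `0`. -/
def starGraph (n : ℕ) : SimpleGraph (Fin n) :=
  SimpleGraph.fromRel fun u _ => (u : ℕ) = 0


namespace SlowC

variable [DecidableEq V]

theorem mis_nonempty {G : SimpleGraph V} {M D : Finset V} (h : G.MaxIndepSubset M D)
    (hM : M.Nonempty) : D.Nonempty := by
  obtain ⟨x, hx⟩ := hM
  by_cases hxD : x ∈ D
  · exact ⟨x, hxD⟩
  · obtain ⟨u, hu, _⟩ := h.2.2 x hx hxD
    exact ⟨u, hu⟩

/-- Independent sets extend to maximal ones. -/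
theorem exists_mis (G : SimpleGraph V) (M D : Finset V) (hD : D ⊆ M)
    (hi : ∀ u ∈ D, ∀ v ∈ D, ¬ G.Adj u v) : ∃ E, G.MaxIndepSubset M E ∧ D ⊆ E := by
  by_cases h : ∀ v ∈ M, v ∉ D → ∃ u ∈ D, G.Adj u v
  · exact ⟨D, ⟨hD, hi, h⟩, subset_rfl⟩
  · push Not at h
    obtain ⟨v, hv, hvD, hn⟩ := h
    have hlt : (M \ insert v D).card < (M \ D).card := by
      apply Finset.card_lt_card
      refine ⟨?_, ?_⟩
      · intro x; simp; tauto
      · intro hs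
        have := hs (show v ∈ M \ D by simp [hv, hvD])
        simp at this
    obtain ⟨E, hE, hDE⟩ := exists_mis G M (insert v D)
      (by intro x hx; rcases Finset.mem_insert.1 hx with rfl | h; exacts [hv, hD h])
      (by
        intro a ha b hb hab
        rcases Finset.mem_insert.1 ha with ha | ha <;> rcases Finset.mem_insert.1 hb with hb | hb
        · rw [ha, hb] at hab
          exact G.loopless.irrefl _ hab
        · rw [ha] at hab
          exact hn b hb hab.symm
        · rw [hb] at hab
          exact hn a ha hab
        · exact hi a ha b hb hab)
    exact ⟨E, hE, fun x hx => hDE (Finset.mem_insert_of_mem hx)⟩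
termination_by (M \ D).card

noncomputable def sc (G : SimpleGraph V) (A : Finset V) : ℕ := G.slowAux A.card A

theorem card_sdiff_lt {A D : Finset V} (h : D ⊆ A) (hD : D.Nonempty) :
    (A \ D).card < A.card := by
  apply Finset.card_lt_card
  refine ⟨Finset.sdiff_subset, fun hs => ?_⟩
  obtain ⟨x, hx⟩ := hD
  have := hs (h hx)
  simp [hx] at this

theorem fuel (G : SimpleGraph V) : ∀ (f : ℕ) (A : Finset V), A.card ≤ f →
    G.slowAux f A = sc G A := by
  intro f
  induction f using Nat.strong_induction_on with
  | _ f ih =>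
    intro A hA
    unfold sc
    rcases f with _ | f
    · have : A.card = 0 := by omega
      rw [this]
    rcases hc : A.card with _ | m
    · rw [Finset.card_eq_zero] at hc
      subst hc
      simp only [SimpleGraph.slowAux]
      have : (Finset.powerset (∅ : Finset V)).filter (fun M => M.Nonempty) = ∅ := by
        ext x; simp
      rw [this]; simp
    · simp only [SimpleGraph.slowAux]
      apply Finset.sup_congr rfl
      intro M hM
      simp only [Finset.mem_filter, Finset.mem_powerset] at hM
      congr 2
      ext k
      have key : ∀ D, G.MaxIndepSubset M D → G.slowAux f (A \ D) = G.slowAux m (A \ D) := by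
        intro D hD
        have := card_sdiff_lt (hD.1.trans hM.1) (mis_nonempty hD hM.2)
        rw [ih f (by omega) _ (by omega), ih m (by omega) _ (by omega)]
      simp only [Set.mem_ofPred_eq]
      constructor
      · rintro ⟨D, hD, rfl⟩; exact ⟨D, hD, key D hD⟩
      · rintro ⟨D, hD, rfl⟩; exact ⟨D, hD, (key D hD).symm⟩

theorem sc_empty (G : SimpleGraph V) : sc G ∅ = 0 := by
  simp [sc, SimpleGraph.slowAux]

theorem sc_resp (G : SimpleGraph V) {A M : Finset V} (hM : M ⊆ A) :
    ∃ D, G.MaxIndepSubset M D ∧ M.card + sc G (A \ D) ≤ sc G A := by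
  rcases M.eq_empty_or_nonempty with rfl | hne
  · exact ⟨∅, ⟨by simp, by simp, by simp⟩, by simp⟩
  have hpos : 0 < A.card := Finset.card_pos.2 (hne.mono hM)
  obtain ⟨m, hm⟩ : ∃ m, A.card = m + 1 := ⟨A.card - 1, by omega⟩
  set S := {k | ∃ D : Finset V, G.MaxIndepSubset M D ∧ k = G.slowAux m (A \ D)} with hS
  have hSne : S.Nonempty := by
    obtain ⟨E, hE, _⟩ := exists_mis G M ∅ (by simp) (by simp)
    exact ⟨_, E, hE, rfl⟩
  obtain ⟨D, hD, hDe⟩ := Nat.sInf_mem hSne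
  refine ⟨D, hD, ?_⟩
  have hlt := card_sdiff_lt (hD.1.trans hM) (mis_nonempty hD hne)
  rw [← fuel G m (A \ D) (by omega), ← hDe]
  conv_rhs => rw [sc, hm, SimpleGraph.slowAux]
  exact Finset.le_sup (f := fun M => M.card + sInf {k | ∃ D : Finset V, G.MaxIndepSubset M D ∧ k = G.slowAux m (A \ D)})
    (by simp [hM, hne])

theorem sc_le (G : SimpleGraph V) {A : Finset V} {c : ℕ}
    (h : ∀ M ⊆ A, M.Nonempty → ∃ D, G.MaxIndepSubset M D ∧ M.card + sc G (A \ D) ≤ c) :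
    sc G A ≤ c := by
  rcases hc : A.card with _ | m
  · simp [sc, hc, SimpleGraph.slowAux]
  rw [sc, hc, SimpleGraph.slowAux]
  apply Finset.sup_le
  intro M hM
  simp only [Finset.mem_filter, Finset.mem_powerset] at hM
  obtain ⟨D, hD, hle⟩ := h M hM.1 hM.2
  have h0 : sInf {k | ∃ D, G.MaxIndepSubset M D ∧ k = G.slowAux m (A \ D)} ≤
      G.slowAux m (A \ D) := Nat.sInf_le ⟨D, hD, rfl⟩
  refine le_trans (Nat.add_le_add_left h0 _) ?_
  have hlt := card_sdiff_lt (hD.1.trans hM.1) (mis_nonempty hD hM.2)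
  rwa [fuel G m _ (by omega)]

theorem sc_mono (G : SimpleGraph V) : ∀ (n : ℕ) (A B : Finset V), A.card = n → B ⊆ A →
    sc G B ≤ sc G A := by
  intro n
  induction n using Nat.strong_induction_on with
  | _ n ih =>
    intro A B hA hB
    apply sc_le
    intro M hM hne
    obtain ⟨D, hD, hle⟩ := sc_resp G (hM.trans hB)
    refine ⟨D, hD, le_trans (Nat.add_le_add_left ?_ _) hle⟩
    have hlt := card_sdiff_lt (hD.1.trans (hM.trans hB)) (mis_nonempty hD hne)
    exact ih _ (by omega) _ _ rfl (Finset.sdiff_subset_sdiff hB subset_rfl)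

theorem mono (G : SimpleGraph V) {A B : Finset V} (h : B ⊆ A) : sc G B ≤ sc G A :=
  sc_mono G _ A B rfl h

/-- Painter may use any independent subset. -/
theorem sc_le' (G : SimpleGraph V) {A : Finset V} {c : ℕ}
    (h : ∀ M ⊆ A, M.Nonempty → ∃ D ⊆ M, (∀ u ∈ D, ∀ v ∈ D, ¬ G.Adj u v) ∧
      M.card + sc G (A \ D) ≤ c) :
    sc G A ≤ c := by
  apply sc_le
  intro M hM hne
  obtain ⟨D, hD, hi, hle⟩ := h M hM hne
  obtain ⟨E, hE, hDE⟩ := exists_mis G M D hD hi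
  exact ⟨E, hE, le_trans (Nat.add_le_add_left
    (mono G (Finset.sdiff_subset_sdiff subset_rfl hDE)) _) hle⟩

theorem edge_mono {G H : SimpleGraph V} (hGH : G ≤ H) : ∀ (n : ℕ) (A : Finset V), A.card = n →
    sc G A ≤ sc H A := by
  intro n
  induction n using Nat.strong_induction_on with
  | _ n ih =>
    intro A hA
    apply sc_le'
    intro M hM hne
    obtain ⟨D, hD, hle⟩ := sc_resp H hM
    refine ⟨D, hD.1, fun u hu v hv huv => hD.2.1 u hu v hv (hGH huv), 
      le_trans (Nat.add_le_add_left ?_ _) hle⟩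
    have hlt := card_sdiff_lt (hD.1.trans hM) (mis_nonempty hD hne)
    exact ih _ (by omega) _ rfl

/-- Lister marks an independent set. -/
theorem indep_add (G : SimpleGraph V) {A I : Finset V} (hI : I ⊆ A)
    (hi : ∀ u ∈ I, ∀ v ∈ I, ¬ G.Adj u v) : I.card + sc G (A \ I) ≤ sc G A := by
  obtain ⟨D, hD, hle⟩ := sc_resp G hI
  have : D = I := by
    apply Finset.Subset.antisymm hD.1
    intro x hx
    by_contra hxD
    obtain ⟨u, hu, hux⟩ := hD.2.2 x hx hxD
    exact hi u (hD.1 hu) x hx hux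
  rwa [this] at hle

/-- Isolated vertices cost at most one each. -/
theorem iso (G : SimpleGraph V) : ∀ (n : ℕ) (B R : Finset V), B.card + R.card = n →
    Disjoint B R → (∀ x ∈ R, ∀ y ∈ B ∪ R, ¬ G.Adj x y) →
    sc G (B ∪ R) ≤ sc G B + R.card := by
  intro n
  induction n using Nat.strong_induction_on with
  | _ n ih =>
    intro B R hn hdis hadj
    apply sc_le'
    intro M hM hne
    obtain ⟨D, hD, hle⟩ := sc_resp G (Finset.inter_subset_right : M ∩ B ⊆ B)
    have hMc : M.card = (M ∩ B).card + (M ∩ R).card := by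
      rw [← Finset.card_union_of_disjoint
        (hdis.mono Finset.inter_subset_right Finset.inter_subset_right),
        ← Finset.inter_union_distrib_left, Finset.inter_eq_left.2 hM]
    have hDB : D ⊆ B := hD.1.trans Finset.inter_subset_right
    have hE : (B ∪ R) \ (D ∪ (M ∩ R)) = (B \ D) ∪ (R \ (M ∩ R)) := by
      ext x
      have := @hDB x
      have : x ∈ B → x ∉ R := fun h => Finset.disjoint_left.1 hdis h
      simp only [Finset.mem_sdiff, Finset.mem_union, Finset.mem_inter]
      tauto
    have hRc : (R \ (M ∩ R)).card + (M ∩ R).card = R.card :=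
      Finset.card_sdiff_add_card_eq_card Finset.inter_subset_right
    have hBc : (B \ D).card + D.card = B.card :=
      Finset.card_sdiff_add_card_eq_card hDB
    refine ⟨D ∪ (M ∩ R), ?_, ?_, ?_⟩
    · exact Finset.union_subset (hD.1.trans Finset.inter_subset_left) Finset.inter_subset_left
    · intro u hu v hv huv
      have h1 : ∀ x ∈ D ∪ (M ∩ R), x ∈ B ∪ R := by
        intro x hx
        have := @hDB x
        simp only [Finset.mem_union, Finset.mem_inter] at hx ⊢
        tauto
      rcases Finset.mem_union.1 hu with hu' | hu'
      · rcases Finset.mem_union.1 hv with hv' | hv'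
        · exact hD.2.1 u hu' v hv' huv
        · exact hadj v (Finset.mem_inter.1 hv').2 u (h1 u hu) huv.symm
      · exact hadj u (Finset.mem_inter.1 hu').2 v (h1 v hv) huv
    · rw [hE]
      have hpos : 0 < D.card + (M ∩ R).card := by
        by_contra h0
        have h1 : D = ∅ := Finset.card_eq_zero.1 (by omega)
        have h2 : (M ∩ R).card = 0 := by omega
        have h3 : (M ∩ B).Nonempty := by
          rw [← Finset.card_pos]
          have := Finset.card_pos.2 hne
          omega
        have := mis_nonempty hD h3
        simp [h1] at this
      have := ih ((B \ D).card + (R \ (M ∩ R)).card) (by omega) _ _ rfl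
        (hdis.mono Finset.sdiff_subset Finset.sdiff_subset)
        (fun x hx y hy => hadj x (Finset.mem_sdiff.1 hx).1 y
          (Finset.union_subset_union Finset.sdiff_subset Finset.sdiff_subset hy))
      omega

theorem card_split {M B R : Finset V} (hM : M ⊆ B ∪ R) (hdis : Disjoint B R) :
    M.card = (M ∩ B).card + (M ∩ R).card := by
  rw [← Finset.card_union_of_disjoint
    (hdis.mono Finset.inter_subset_right Finset.inter_subset_right),
    ← Finset.inter_union_distrib_left, Finset.inter_eq_left.2 hM]

theorem sdiff_split {M B R D : Finset V} (hD : D ⊆ B) (hdis : Disjoint B R) :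
    (B ∪ R) \ (D ∪ (M ∩ R)) = (B \ D) ∪ (R \ (M ∩ R)) := by
  ext x
  have := @hD x
  have : x ∈ B → x ∉ R := fun h => Finset.disjoint_left.1 hdis h
  simp only [Finset.mem_sdiff, Finset.mem_union, Finset.mem_inter]
  tauto

/-- Leaves `R` attached to `v ∈ B`. -/
theorem U1 (G : SimpleGraph V) (v : V) : ∀ (n : ℕ) (k : ℕ) (B R : Finset V),
    B.card + R.card = n → v ∈ B →
    Disjoint B R → (∀ x ∈ R, ∀ y ∈ B ∪ R, G.Adj x y → y = v) →
    2 * (R.card + 1) ≤ (k + 1) * (k + 2) →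
    sc G (B ∪ R) ≤ sc G B + R.card + k := by
  intro n
  induction n using Nat.strong_induction_on with
  | _ n ih =>
    intro k B R hn hv hdis hadj hk
    have hvR : v ∉ R := Finset.disjoint_left.1 hdis hv
    apply sc_le'
    intro M hM hne
    have hMc := card_split hM hdis
    have hRc : (R \ (M ∩ R)).card + (M ∩ R).card = R.card :=
      Finset.card_sdiff_add_card_eq_card Finset.inter_subset_right
    have hsub : ∀ D ⊆ B, (R \ (M ∩ R)).card = (R \ (M ∩ R)).card ∧
        ∀ x ∈ R \ (M ∩ R), ∀ y ∈ (B \ D) ∪ (R \ (M ∩ R)), G.Adj x y → y = v := by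
      intro D _
      exact ⟨rfl, fun x hx y hy => hadj x (Finset.mem_sdiff.1 hx).1 y
          (Finset.union_subset_union Finset.sdiff_subset Finset.sdiff_subset hy)⟩
    have hind : ∀ D ⊆ B, v ∉ D → (∀ u ∈ D, ∀ w ∈ D, ¬ G.Adj u w) →
        ∀ u ∈ D ∪ (M ∩ R), ∀ w ∈ D ∪ (M ∩ R), ¬ G.Adj u w := by
      intro D hDB hvD hDi u hu w hw huw
      have h1 : ∀ x ∈ D ∪ (M ∩ R), x ∈ B ∪ R ∧ x ≠ v := by
        intro x hx
        have := @hDB x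
        simp only [Finset.mem_union, Finset.mem_inter] at hx ⊢
        refine ⟨by tauto, ?_⟩
        rintro rfl
        tauto
      rcases Finset.mem_union.1 hu with hu' | hu'
      · rcases Finset.mem_union.1 hw with hw' | hw'
        · exact hDi u hu' w hw' huw
        · exact (h1 u hu).2 (hadj w (Finset.mem_inter.1 hw').2 u (h1 u hu).1 huw.symm)
      · exact (h1 w hw).2 (hadj u (Finset.mem_inter.1 hu').2 w (h1 w hw).1 huw)
    obtain ⟨D, hD, hle⟩ := sc_resp G (Finset.inter_subset_right : M ∩ B ⊆ B)
    have hDB : D ⊆ B := hD.1.trans Finset.inter_subset_right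
    have hDM : D ⊆ M := hD.1.trans Finset.inter_subset_left
    have hBc : (B \ D).card + D.card = B.card :=
      Finset.card_sdiff_add_card_eq_card hDB
    by_cases hvD : v ∈ D
    · by_cases hq : (M ∩ R).card ≤ k
      · refine ⟨D, hDM, hD.2.1, ?_⟩
        have hE : (B ∪ R) \ D = (B \ D) ∪ R := by
          ext x
          have := @hDB x
          have : x ∈ B → x ∉ R := fun h => Finset.disjoint_left.1 hdis h
          simp only [Finset.mem_sdiff, Finset.mem_union]
          tauto
        rw [hE]
        have := iso G _ (B \ D) R rfl (hdis.mono_left Finset.sdiff_subset) (by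
          intro x hx y hy hxy
          have h2 := hadj x hx y (Finset.union_subset_union Finset.sdiff_subset subset_rfl hy) hxy
          subst h2
          rcases Finset.mem_union.1 hy with h | h
          · exact (Finset.mem_sdiff.1 h).2 hvD
          · exact hvR h)
        omega
      · have hvM : v ∈ M ∩ B := hD.1 hvD
        obtain ⟨D2, hD2, hle2⟩ := sc_resp G
          ((Finset.erase_subset v _).trans Finset.inter_subset_right : (M ∩ B).erase v ⊆ B)
        have hD2' : D2 ⊆ M ∩ B := hD2.1.trans (Finset.erase_subset _ _)
        have hD2B : D2 ⊆ B := hD2'.trans Finset.inter_subset_right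
        have hvD2 : v ∉ D2 := fun h => Finset.notMem_erase v _ (hD2.1 h)
        refine ⟨D2 ∪ (M ∩ R), Finset.union_subset (hD2'.trans Finset.inter_subset_left)
          Finset.inter_subset_left, hind D2 hD2B hvD2 hD2.2.1, ?_⟩
        rw [sdiff_split hD2B hdis]
        have hBc2 : (B \ D2).card + D2.card = B.card :=
          Finset.card_sdiff_add_card_eq_card hD2B
        have hce : ((M ∩ B).erase v).card + 1 = (M ∩ B).card := Finset.card_erase_add_one hvM
        obtain ⟨j, rfl⟩ : ∃ j, k = j + 1 := by
          rcases k with _ | j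
          · omega
          · exact ⟨j, rfl⟩
        have := ih ((B \ D2).card + (R \ (M ∩ R)).card) (by omega) j _ _ rfl
          (Finset.mem_sdiff.2 ⟨hv, hvD2⟩)
          (hdis.mono Finset.sdiff_subset Finset.sdiff_subset) (hsub D2 hD2B).2 (by nlinarith)
        omega
    · refine ⟨D ∪ (M ∩ R), Finset.union_subset hDM Finset.inter_subset_left,
        hind D hDB hvD hD.2.1, ?_⟩
      rw [sdiff_split hDB hdis]
      have hpos : 0 < D.card + (M ∩ R).card := by
        by_contra h0
        have h1 : D = ∅ := Finset.card_eq_zero.1 (by omega)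
        have h2 : (M ∩ R).card = 0 := by omega
        have h3 : (M ∩ B).Nonempty := by
          rw [← Finset.card_pos]
          have := Finset.card_pos.2 hne
          omega
        have := mis_nonempty hD h3
        simp [h1] at this
      have := ih ((B \ D).card + (R \ (M ∩ R)).card) (by omega) k _ _ rfl
          (Finset.mem_sdiff.2 ⟨hv, hvD⟩)
          (hdis.mono Finset.sdiff_subset Finset.sdiff_subset) (hsub D hDB).2 (by nlinarith)
      omega

/-- A star component. -/
theorem star (G : SimpleGraph V) (v : V) (k : ℕ) (A R : Finset V) (hv : v ∉ A) (hvR : v ∉ R)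
    (hdis : Disjoint A R) (hadj : ∀ x ∈ R, ∀ y ∈ insert v A ∪ R, G.Adj x y → y = v)
    (hvA : ∀ y ∈ A, ¬ G.Adj v y)
    (hk : 2 * (R.card + 1) ≤ (k + 1) * (k + 2)) :
    sc G (insert v A ∪ R) ≤ sc G A + R.card + 1 + k := by
  have h1 := U1 G v _ k (insert v A) R rfl (by simp) (by simp [hvR, hdis]) hadj hk
  have h2 := iso G _ A {v} rfl (by simpa using hv) (by
    intro x hx y hy
    rw [Finset.mem_singleton.1 hx]
    rcases Finset.mem_union.1 hy with h | h
    · exact hvA y h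
    · rw [Finset.mem_singleton.1 h]; exact G.loopless.irrefl _)
  have h3 : A ∪ {v} = insert v A := by ext; simp
  rw [h3] at h2
  simp at h2
  omega

theorem U2 (G : SimpleGraph V) (v : V) : ∀ (n : ℕ) (k : ℕ) (A R : Finset V),
    A.card + R.card = n → v ∉ A → v ∉ R →
    Disjoint A R → (∀ x ∈ R, ∀ y ∈ insert v A ∪ R, G.Adj x y → y = v) →
    (∀ x ∈ A, ∀ y ∈ A, G.Adj v x → G.Adj v y → x = y) →
    2 * (R.card + 2) ≤ (k + 1) * (k + 2) →
    sc G (insert v A ∪ R) ≤ sc G A + R.card + 1 + k := by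
  intro n
  induction n using Nat.strong_induction_on with
  | _ n ih =>
    intro k A R hn hvA hvR hdis hadj hone hk
    have hdis' : Disjoint (insert v A) R := by simp [hvR, hdis]
    apply sc_le'
    intro M hM hne
    have hMc := card_split hM hdis'
    have hRc : (R \ (M ∩ R)).card + (M ∩ R).card = R.card :=
      Finset.card_sdiff_add_card_eq_card Finset.inter_subset_right
    have hadjA : ∀ x ∈ R, ∀ y ∈ A, ¬ G.Adj x y := by
      intro x hx y hy hxy
      have := hadj x hx y (by simp [hy]) hxy
      exact hvA (this ▸ hy)
    have hadjR : ∀ x ∈ R, ∀ y ∈ R, ¬ G.Adj x y := by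
      intro x hx y hy hxy
      have := hadj x hx y (by simp [hy]) hxy
      exact hvR (this ▸ hy)
    have hsub : ∀ D : Finset V,
        ∀ x ∈ R \ (M ∩ R), ∀ y ∈ (insert v (A \ D)) ∪ (R \ (M ∩ R)), G.Adj x y → y = v := by
      intro D x hx y hy
      exact hadj x (Finset.mem_sdiff.1 hx).1 y
          (Finset.union_subset_union (Finset.insert_subset_insert _ Finset.sdiff_subset)
            Finset.sdiff_subset hy)
    have hone' : ∀ D : Finset V, 
        ∀ x ∈ A \ D, ∀ y ∈ A \ D, G.Adj v x → G.Adj v y → x = y := by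
      intro D x hx y hy
      exact hone x (Finset.mem_sdiff.1 hx).1 y (Finset.mem_sdiff.1 hy).1
    have hindR : ∀ D ⊆ A, (∀ u ∈ D, ∀ w ∈ D, ¬ G.Adj u w) →
        ∀ u ∈ D ∪ (M ∩ R), ∀ w ∈ D ∪ (M ∩ R), ¬ G.Adj u w := by
      intro D hDA hDi u hu w hw huw
      rcases Finset.mem_union.1 hu with hu' | hu' <;> rcases Finset.mem_union.1 hw with hw' | hw'
      · exact hDi u hu' w hw' huw
      · exact hadjA w (Finset.mem_inter.1 hw').2 u (hDA hu') huw.symm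
      · exact hadjA u (Finset.mem_inter.1 hu').2 w (hDA hw') huw
      · exact hadjR u (Finset.mem_inter.1 hu').2 w (Finset.mem_inter.1 hw').2 huw
    have hER : ∀ D ⊆ A, (insert v A ∪ R) \ (D ∪ (M ∩ R)) =
        insert v (A \ D) ∪ (R \ (M ∩ R)) := by
      intro D hDA
      rw [sdiff_split (hDA.trans (Finset.subset_insert _ _)) hdis',
        Finset.insert_sdiff_of_notMem _ (fun h => hvA (hDA h))]
    have hisoA : ∀ D ⊆ A, sc G ((insert v A ∪ R) \ insert v D) ≤ sc G (A \ D) + R.card := by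
      intro D hDA
      have hE : (insert v A ∪ R) \ insert v D = (A \ D) ∪ R := by
        ext x
        have := @hDA x
        have : x ∈ A → x ∉ R := fun h => Finset.disjoint_left.1 hdis h
        have h3 : x = v → x ∉ A ∧ x ∉ R := by rintro rfl; exact ⟨hvA, hvR⟩
        simp only [Finset.mem_sdiff, Finset.mem_union, Finset.mem_insert]
        tauto
      rw [hE]
      apply iso G _ (A \ D) R rfl (hdis.mono_left Finset.sdiff_subset)
      intro x hx y hy
      rcases Finset.mem_union.1 hy with h | h
      · exact hadjA x hx y (Finset.mem_sdiff.1 h).1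
      · exact hadjR x hx y h
    have hindv : ∀ D ⊆ A, (∀ u ∈ D, ∀ w ∈ D, ¬ G.Adj u w) → (∀ u ∈ D, ¬ G.Adj v u) →
        ∀ u ∈ insert v D, ∀ w ∈ insert v D, ¬ G.Adj u w := by
      intro D hDA hDi hDv u hu w hw huw
      rcases Finset.mem_insert.1 hu with hu' | hu' <;> rcases Finset.mem_insert.1 hw with hw' | hw'
      · rw [hu', hw'] at huw; exact G.loopless.irrefl _ huw
      · rw [hu'] at huw; exact hDv w hw' huw
      · rw [hw'] at huw; exact hDv u hu' huw.symm
      · exact hDi u hu' w hw' huw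
    obtain ⟨D, hD, hle⟩ := sc_resp G (Finset.inter_subset_right : M ∩ A ⊆ A)
    have hDA : D ⊆ A := hD.1.trans Finset.inter_subset_right
    have hDM : D ⊆ M := hD.1.trans Finset.inter_subset_left
    have hAc : (A \ D).card + D.card = A.card :=
      Finset.card_sdiff_add_card_eq_card hDA
    have hvA' : ∀ D : Finset V, v ∉ A \ D := fun D h => hvA (Finset.mem_sdiff.1 h).1
    have hvR' : v ∉ R \ (M ∩ R) := fun h => hvR (Finset.mem_sdiff.1 h).1
    by_cases hvM : v ∈ M
    · have hMc' : M.card = (M ∩ A).card + 1 + (M ∩ R).card := by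
        rw [hMc, Finset.inter_insert_of_mem hvM, Finset.card_insert_of_notMem]
        exact fun h => hvA (Finset.mem_inter.1 h).2
      obtain ⟨j, rfl⟩ : ∃ j, k = j + 1 := by
        rcases k with _ | j
        · omega
        · exact ⟨j, rfl⟩
      by_cases hq : (M ∩ R).card ≤ j + 1
      · by_cases hw : ∀ u ∈ D, ¬ G.Adj v u
        · refine ⟨insert v D, Finset.insert_subset hvM hDM, hindv D hDA hD.2.1 hw, ?_⟩
          have := hisoA D hDA
          omega
        · push Not at hw
          obtain ⟨w, hwD, hvw⟩ := hw
          by_cases hq' : (M ∩ R).card = j + 1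
          · refine ⟨D ∪ (M ∩ R), Finset.union_subset hDM Finset.inter_subset_left,
              hindR D hDA hD.2.1, ?_⟩
            rw [hER D hDA]
            have := star G v j (A \ D) (R \ (M ∩ R)) (hvA' D) hvR'
              (hdis.mono Finset.sdiff_subset Finset.sdiff_subset) (hsub D) (by
                intro y hy hvy
                have := hone y (Finset.mem_sdiff.1 hy).1 w (hDA hwD) hvy hvw
                exact (Finset.mem_sdiff.1 hy).2 (this ▸ hwD)) (by nlinarith)
            omega
          · have hwM : w ∈ M ∩ A := hD.1 hwD
            obtain ⟨D2, hD2, hle2⟩ := sc_resp G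
              ((Finset.erase_subset w _).trans Finset.inter_subset_right : (M ∩ A).erase w ⊆ A)
            have hD2' : D2 ⊆ M ∩ A := hD2.1.trans (Finset.erase_subset _ _)
            have hD2A : D2 ⊆ A := hD2'.trans Finset.inter_subset_right
            have hce : ((M ∩ A).erase w).card + 1 = (M ∩ A).card := Finset.card_erase_add_one hwM
            refine ⟨insert v D2, Finset.insert_subset hvM
              (hD2'.trans Finset.inter_subset_left), hindv D2 hD2A hD2.2.1 ?_, ?_⟩
            · intro u hu hvu
              have := hone u (hD2A hu) w (hDA hwD) hvu hvw
              subst this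
              exact Finset.notMem_erase _ _ (hD2.1 hu)
            · have := hisoA D2 hD2A
              omega
      · refine ⟨D ∪ (M ∩ R), Finset.union_subset hDM Finset.inter_subset_left,
          hindR D hDA hD.2.1, ?_⟩
        rw [hER D hDA]
        have := ih ((A \ D).card + (R \ (M ∩ R)).card) (by omega) j _ _ rfl
          (hvA' D) hvR' (hdis.mono Finset.sdiff_subset Finset.sdiff_subset) (hsub D) (hone' D)
          (by nlinarith)
        omega
    · have hMc' : M.card = (M ∩ A).card + (M ∩ R).card := by
        rw [hMc, Finset.inter_insert_of_notMem hvM]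
      refine ⟨D ∪ (M ∩ R), Finset.union_subset hDM Finset.inter_subset_left,
          hindR D hDA hD.2.1, ?_⟩
      rw [hER D hDA]
      have hpos : 0 < D.card + (M ∩ R).card := by
        by_contra h0
        have h1 : D = ∅ := Finset.card_eq_zero.1 (by omega)
        have h2 : (M ∩ R).card = 0 := by omega
        have h3 : (M ∩ A).Nonempty := by
          rw [← Finset.card_pos]
          have := Finset.card_pos.2 hne
          omega
        have := mis_nonempty hD h3
        simp [h1] at this
      have := ih ((A \ D).card + (R \ (M ∩ R)).card) (by omega) k _ _ rfl
          (hvA' D) hvR' (hdis.mono Finset.sdiff_subset Finset.sdiff_subset) (hsub D) (hone' D)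
          (by nlinarith)
      omega

/-- Marking a star. -/
theorem mis_star {G : SimpleGraph V} {v : V} {Q D : Finset V} 
    (hadj : ∀ x ∈ Q, G.Adj v x)
    (hi : ∀ x ∈ Q, ∀ y ∈ Q, ¬ G.Adj x y) (h : G.MaxIndepSubset (insert v Q) D) :
    D = {v} ∨ D = Q := by
  by_cases hv : v ∈ D
  · left
    apply Finset.Subset.antisymm
    · intro x hx
      rcases Finset.mem_insert.1 (h.1 hx) with h1 | h1
      · simp [h1]
      · exact absurd (hadj x h1) (h.2.1 v hv x hx)
    · simpa using hv
  · right
    have hDQ : D ⊆ Q := by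
      intro x hx
      rcases Finset.mem_insert.1 (h.1 hx) with h1 | h1
      · exact absurd (h1 ▸ hx) hv
      · exact h1
    apply Finset.Subset.antisymm hDQ
    intro x hx
    by_contra hxD
    obtain ⟨u, hu, hux⟩ := h.2.2 x (Finset.mem_insert_of_mem hx) hxD
    exact hi u (hDQ hu) x hx hux

theorem edge_lower (G : SimpleGraph V) {A : Finset V} {v x : V} (hv : v ∈ A) (hx : x ∈ A)
    (h : G.Adj v x) : 3 + sc G (A \ {v, x}) ≤ sc G A := by
  have hne : v ≠ x := h.ne
  obtain ⟨D, hD, hle⟩ := sc_resp G (show insert v {x} ⊆ A by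
    intro y; simp; rintro (rfl | rfl) <;> assumption)
  have hc : (insert v {x} : Finset V).card = 2 := Finset.card_pair hne
  have hs : ∀ a b : V, a ∈ A → b ∈ A → a ≠ b → 1 + sc G (A \ {a, b}) ≤ sc G (A \ {a}) := by
    intro a b ha hb hab
    have := indep_add G (A := A \ {a}) (I := {b}) (by simp [hb, hab.symm]) (by
      intro u hu w hw
      simp at hu hw
      subst hu; subst hw
      exact G.loopless.irrefl _)
    have he : (A \ {a}) \ {b} = A \ {a, b} := by ext; simp; tauto
    rw [he] at this
    simpa using this
  rcases mis_star (by simpa using h) (by simp) hD with rfl | rfl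
  · have := hs v x hv hx hne
    omega
  · have := hs x v hx hv hne.symm
    rw [Finset.pair_comm] at this
    omega

theorem pendant (G : SimpleGraph V) {B : Finset V} {v : V} (hv : v ∈ B)
    (hone : ∀ x ∈ B, ∀ y ∈ B, G.Adj v x → G.Adj v y → x = y) :
    sc G B ≤ sc G (B.erase v) + 2 := by
  have := U2 G v _ 1 (B.erase v) ∅ rfl (by simp) (by simp) (by simp) (by simp)
    (fun x hx y hy => hone x (Finset.mem_of_mem_erase hx) y (Finset.mem_of_mem_erase hy))
    (by simp)
  rw [Finset.insert_erase hv, Finset.union_empty] at this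
  simpa using this

/-- General step of the lower bound: mark `v` and `Q ⊆ R`. -/
theorem leaf_lower_step (G : SimpleGraph V) {A R Q : Finset V} {v : V} (hv : v ∈ A)
    (hR : R ⊆ A) (hQ : Q ⊆ R) 
    (hadj : ∀ x ∈ R, G.Adj v x) (hi : ∀ x ∈ R, ∀ y ∈ R, ¬ G.Adj x y)
    (hone : ∀ x ∈ A \ R, ∀ y ∈ A \ R, G.Adj v x → G.Adj v y → x = y) (c : ℕ)
    (hc : c + 1 ≤ R.card + Q.card)
    (hstep : sc G (A \ R) + c ≤ sc G (A \ Q) + Q.card + 1) :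
    sc G (A \ R) + c ≤ sc G A := by
  have hvR : v ∉ R := fun h => G.loopless.irrefl _ (hadj v h)
  have hvQ : v ∉ Q := fun h => hvR (hQ h)
  obtain ⟨D, hD, hle⟩ := sc_resp G (show insert v Q ⊆ A from
    Finset.insert_subset hv (hQ.trans hR))
  rw [Finset.card_insert_of_notMem hvQ] at hle
  rcases mis_star (fun x hx => hadj x (hQ hx)) (fun x hx y hy => hi x (hQ hx) y (hQ hy)) hD
    with rfl | rfl
  · have h1 := indep_add G (A := A \ {v}) (I := R) (by
      intro x hx
      simp only [Finset.mem_sdiff, Finset.mem_singleton]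
      exact ⟨hR hx, fun h => hvR (h ▸ hx)⟩) hi
    have h2 := pendant G (B := A \ R) (v := v) (by simp [hv, hvR]) hone
    have h3 : (A \ R).erase v = (A \ {v}) \ R := by ext; simp; tauto
    rw [h3] at h2
    omega
  · omega

theorem leaf_lower2 (G : SimpleGraph V) {A R : Finset V} {v : V} (hv : v ∈ A)
    (hR : R ⊆ A) (hadj : ∀ x ∈ R, G.Adj v x) (hi : ∀ x ∈ R, ∀ y ∈ R, ¬ G.Adj x y)
    (hone : ∀ x ∈ A \ R, ∀ y ∈ A \ R, G.Adj v x → G.Adj v y → x = y) (hc : R.card = 2) :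
    sc G (A \ R) + 3 ≤ sc G A :=
  leaf_lower_step G hv hR subset_rfl hadj hi hone 3 (by omega) (by omega)

theorem leaf_lower5 (G : SimpleGraph V) {A R : Finset V} {v : V} (hv : v ∈ A)
    (hR : R ⊆ A) (hadj : ∀ x ∈ R, G.Adj v x) (hi : ∀ x ∈ R, ∀ y ∈ R, ¬ G.Adj x y)
    (hone : ∀ x ∈ A \ R, ∀ y ∈ A \ R, G.Adj v x → G.Adj v y → x = y) (hc : R.card = 5) :
    sc G (A \ R) + 7 ≤ sc G A := by
  obtain ⟨Q, hQ, hQc⟩ := Finset.exists_subset_card_eq (show 3 ≤ R.card by omega)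
  refine leaf_lower_step G hv hR hQ hadj hi hone 7 (by omega) ?_
  have hvR : v ∉ R := fun h => G.loopless.irrefl _ (hadj v h)
  have he : (A \ Q) \ (R \ Q) = A \ R := by
    ext x
    have := @hQ x
    simp only [Finset.mem_sdiff]; tauto
  have hcs := Finset.card_sdiff_add_card_eq_card hQ
  have := leaf_lower2 G (A := A \ Q) (R := R \ Q) (v := v)
    (by simp only [Finset.mem_sdiff]; exact ⟨hv, fun h => hvR (hQ h)⟩)
    (Finset.sdiff_subset_sdiff hR subset_rfl)
    (fun x hx => hadj x (Finset.mem_sdiff.1 hx).1)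
    (fun x hx y hy => hi x (Finset.mem_sdiff.1 hx).1 y (Finset.mem_sdiff.1 hy).1)
    (by rw [he]; exact hone) (by omega)
  rw [he] at this
  omega

theorem exists_low (G : SimpleGraph V) (hG : G.IsAcyclic) (B : Finset V) (hB : B.Nonempty) :
    ∃ v ∈ B, ∀ x ∈ B, ∀ y ∈ B, G.Adj v x → G.Adj v y → x = y := by
  classical
  have hI : (G.induce (B : Set V)).IsAcyclic := hG.induce _
  have : Nonempty (B : Set V) := hB.to_subtype
  have : Finite (G.induce (B : Set V)).edgeSet := inferInstance
  obtain ⟨u, v, p, hp, hmax⟩ :=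
    SimpleGraph.Walk.exists_isPath_forall_isPath_length_le_length (G.induce (B : Set V))
  have key : ∀ w, (G.induce (B : Set V)).Adj u w → w = p.snd := by
    intro w hadj
    apply hI.eq_snd_of_adj_start hp hadj
    have : ¬(p.cons hadj.symm).IsPath := by
      intro h
      have := hmax _ _ _ h
      simp at this
    by_contra hw
    exact this (hp.cons hw)
  refine ⟨u.1, u.2, fun x hx y hy hux huy => ?_⟩
  have h1 := key ⟨x, hx⟩ (by simpa using hux)
  have h2 := key ⟨y, hy⟩ (by simpa using huy)
  have := h1.trans h2.symm
  simpa using this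

theorem find_v (G : SimpleGraph V) (hG : G.IsAcyclic) (A : Finset V) (hA : A.Nonempty)
    (hiso : ∀ x ∈ A, ∃ y ∈ A, G.Adj x y) :
    ∃ v ∈ A, ∃ R ⊆ A, R.Nonempty ∧ v ∉ R ∧ (∀ x ∈ R, G.Adj v x) ∧
      (∀ x ∈ R, ∀ y ∈ A, G.Adj x y → y = v) ∧
      (∀ x ∈ A \ R, ∀ y ∈ A \ R, G.Adj v x → G.Adj v y → x = y) := by
  classical
  set L := A.filter (fun x => ∀ a ∈ A, ∀ b ∈ A, G.Adj x a → G.Adj x b → a = b) with hL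
  suffices h : ∃ v ∈ A, (∃ x ∈ L, G.Adj v x) ∧
      ∀ x ∈ A \ L, ∀ y ∈ A \ L, G.Adj v x → G.Adj v y → x = y by
    obtain ⟨v, hv, ⟨x, hx, hvx⟩, hone⟩ := h
    refine ⟨v, hv, L.filter (G.Adj v), ?_, ⟨x, by simp [hx, hvx]⟩, ?_, ?_, ?_, ?_⟩
    · intro y hy
      exact (Finset.mem_filter.1 (Finset.mem_filter.1 hy).1).1
    · simp
    · intro y hy
      exact (Finset.mem_filter.1 hy).2
    · intro y hy z hz hyz
      have h1 := Finset.mem_filter.1 hy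
      exact (Finset.mem_filter.1 h1.1).2 z hz v hv hyz h1.2.symm
    · intro a ha b hb hva hvb
      refine hone a ?_ b ?_ hva hvb
      · simp only [Finset.mem_sdiff, Finset.mem_filter, not_and] at ha ⊢
        exact ⟨ha.1, fun h => ha.2 h hva⟩
      · simp only [Finset.mem_sdiff, Finset.mem_filter, not_and] at hb ⊢
        exact ⟨hb.1, fun h => hb.2 h hvb⟩
  rcases (A \ L).eq_empty_or_nonempty with he | hne
  · obtain ⟨v, hv⟩ := hA
    obtain ⟨y, hy, hvy⟩ := hiso v hv
    refine ⟨v, hv, ⟨y, ?_, hvy⟩, by simp [he]⟩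
    by_contra h
    have : y ∈ A \ L := Finset.mem_sdiff.2 ⟨hy, h⟩
    simp [he] at this
  · obtain ⟨v, hv, hone⟩ := exists_low G hG (A \ L) hne
    have hvA := (Finset.mem_sdiff.1 hv).1
    refine ⟨v, hvA, ?_, hone⟩
    by_contra hcon
    push Not at hcon
    apply (Finset.mem_sdiff.1 hv).2
    rw [hL, Finset.mem_filter]
    refine ⟨hvA, fun a ha b hb hva hvb => hone a ?_ b ?_ hva hvb⟩
    · exact Finset.mem_sdiff.2 ⟨ha, fun h => hcon a h hva⟩
    · exact Finset.mem_sdiff.2 ⟨hb, fun h => hcon b h hvb⟩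

open Classical in
/-- Degree into a set. -/
noncomputable def dg (G : SimpleGraph V) (A : Finset V) (v : V) : ℕ := (A.filter (G.Adj v)).card

def Good (G : SimpleGraph V) (A : Finset V) : Prop :=
  (Even A.card → ∀ v ∈ A, dg G A v = 1 ∨ dg G A v = 3) ∧
  (¬ Even A.card → ∃ v₀ ∈ A, (dg G A v₀ = 0 ∨ dg G A v₀ = 6) ∧
    ∀ v ∈ A, v ≠ v₀ → dg G A v = 1 ∨ dg G A v = 3)

theorem dg_congr (G H : SimpleGraph V) {A B : Finset V} {v : V}
    (h : ∀ x, (x ∈ A ∧ G.Adj v x) ↔ (x ∈ B ∧ H.Adj v x)) : dg G A v = dg H B v := by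
  classical
  unfold dg
  congr 1
  ext x
  simpa using h x

theorem dg_sdiff (G : SimpleGraph V) {A R : Finset V} {v : V} (hR : R ⊆ A)
    (h : ∀ x ∈ R, G.Adj v x) : dg G (A \ R) v + R.card = dg G A v := by
  classical
  unfold dg
  rw [← Finset.card_union_of_disjoint]
  · congr 1
    ext x
    have := @hR x
    have := h x
    simp only [Finset.mem_union, Finset.mem_filter, Finset.mem_sdiff]
    tauto
  · rw [Finset.disjoint_left]
    intro x hx hx'
    simp [hx'] at hx

theorem dg_le_one (G : SimpleGraph V) {A : Finset V} {v : V}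
    (h : ∀ x ∈ A, ∀ y ∈ A, G.Adj v x → G.Adj v y → x = y) : dg G A v ≤ 1 := by
  classical
  unfold dg
  rw [Finset.card_le_one]
  intro a ha b hb
  simp only [Finset.mem_filter] at ha hb
  exact h a ha.1 b hb.1 ha.2 hb.2

theorem dg_eq_zero (G : SimpleGraph V) {A : Finset V} {v : V} :
    dg G A v = 0 ↔ ∀ x ∈ A, ¬ G.Adj v x := by
  classical
  unfold dg
  rw [Finset.card_eq_zero, Finset.filter_eq_empty_iff]

theorem dg_leaf (G : SimpleGraph V) {A : Finset V} {v x : V} (hv : v ∈ A)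
    (h : G.Adj x v) (h1 : ∀ y ∈ A, G.Adj x y → y = v) : dg G A x = 1 := by
  have h2 := dg_le_one G (A := A) (v := x) (fun a ha b hb h3 h4 => by
    rw [h1 a ha h3, h1 b hb h4])
  have h3 : dg G A x ≠ 0 := fun h0 => (dg_eq_zero G).1 h0 v hv h
  omega

theorem lower (G : SimpleGraph V) (hG : G.IsAcyclic) : ∀ (n : ℕ) (A : Finset V), A.card = n →
    Good G A → 3 * A.card / 2 ≤ sc G A := by
  intro n
  induction n using Nat.strong_induction_on with
  | _ n ih =>
    intro A hn hgood
    rcases A.eq_empty_or_nonempty with rfl | hne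
    · simp
    by_cases hiso : ∀ x ∈ A, ∃ y ∈ A, G.Adj x y
    · obtain ⟨v, hv, R, hRA, hRne, hvR, hadj, hleaf, hone⟩ := find_v G hG A hne hiso
      have hRi : ∀ x ∈ R, ∀ y ∈ R, ¬ G.Adj x y := fun x hx y hy hxy =>
        hvR (hleaf x hx y (hRA hy) hxy ▸ hy)
      have hRd : ∀ x ∈ R, dg G A x = 1 := fun x hx =>
        dg_leaf G hv (hadj x hx).symm (hleaf x hx)
      have hRpos := Finset.card_pos.2 hRne
      have hdR := dg_sdiff G hRA hadj
      have hd1 := dg_le_one G hone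
      -- degrees unaffected by the removal of leaves
      have hun : ∀ R0 ⊆ R, ∀ y ∈ A \ R0, y ≠ v → dg G (A \ R0) y = dg G A y := by
        intro R0 hR0 y hy hyv
        apply dg_congr
        intro x
        constructor
        · rintro ⟨h1, h2⟩; exact ⟨(Finset.mem_sdiff.1 h1).1, h2⟩
        · rintro ⟨h1, h2⟩
          refine ⟨Finset.mem_sdiff.2 ⟨h1, fun h => ?_⟩, h2⟩
          exact hyv (hleaf x (hR0 h) y (Finset.mem_sdiff.1 hy).1 h2.symm)
      have hone0 : ∀ R0 ⊆ R, dg G (A \ R0) v ≤ 1 →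
          ∀ x ∈ A \ R0, ∀ y ∈ A \ R0, G.Adj v x → G.Adj v y → x = y := by
        classical
        intro R0 hR0 h x hx y hy hvx hvy
        unfold dg at h
        rw [Finset.card_le_one] at h
        exact h x (Finset.mem_filter.2 ⟨hx, hvx⟩) y (Finset.mem_filter.2 ⟨hy, hvy⟩)
      have hdv : dg G A v = 1 ∨ dg G A v = 3 ∨
          (dg G A v = 6 ∧ ¬ Even A.card ∧ ∀ y ∈ A, y ≠ v → dg G A y = 1 ∨ dg G A y = 3) := by
        by_cases he : Even A.card
        · rcases hgood.1 he v hv with h | h <;> simp [h]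
        · obtain ⟨v0, hv0, hd0, hall⟩ := hgood.2 he
          by_cases hvv : v = v0
          · subst hvv
            rcases hd0 with h | h
            · omega
            · exact Or.inr (Or.inr ⟨h, he, hall⟩)
          · rcases hall v hv hvv with h | h <;> simp [h]
      rcases hdv with h1 | h3 | ⟨h6, hodd, hall⟩
      · -- an isolated edge
        have hRc : R.card = 1 := by omega
        obtain ⟨x, rfl⟩ := Finset.card_eq_one.1 hRc
        have hxA : x ∈ A := hRA (by simp)
        have hvx : G.Adj v x := hadj x (by simp)
        have hlow := edge_lower G hv hxA hvx
        have hsub : ({v, x} : Finset V) ⊆ A := by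
          intro y; simp; rintro (rfl | rfl) <;> assumption
        have hc := Finset.card_sdiff_add_card_eq_card hsub
        rw [Finset.card_pair hvx.ne] at hc
        have hv0 : dg G (A \ {x}) v = 0 := by simp at hdR; omega
        rw [dg_eq_zero] at hv0
        have hsame : ∀ y ∈ A \ {v, x}, dg G (A \ {v, x}) y = dg G A y := by
          intro y hy
          simp only [Finset.mem_sdiff, Finset.mem_insert, Finset.mem_singleton, not_or] at hy
          apply dg_congr
          intro z
          simp only [Finset.mem_sdiff, Finset.mem_insert, Finset.mem_singleton, not_or]
          constructor
          · rintro ⟨h1, h2⟩; exact ⟨h1.1, h2⟩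
          · rintro ⟨h1, h2⟩
            refine ⟨⟨h1, ?_, ?_⟩, h2⟩
            · rintro rfl
              exact hv0 y (by simp [hy]) h2.symm
            · rintro rfl
              exact hy.2.1 (hleaf z (by simp) y hy.1 h2.symm)
        have hg : Good G (A \ {v, x}) := by
          refine ⟨fun he y hy => ?_, fun he => ?_⟩
          · rw [hsame y hy]
            exact hgood.1 (by rw [← hc]; simpa [Nat.even_add] using he) y (Finset.mem_sdiff.1 hy).1
          · obtain ⟨v0, hv0A, hd0, hall⟩ := hgood.2 (by rw [← hc]; simpa [Nat.even_add] using he)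
            have hv0' : v0 ∈ A \ {v, x} := by
              simp only [Finset.mem_sdiff, Finset.mem_insert, Finset.mem_singleton, not_or]
              refine ⟨hv0A, ?_, ?_⟩
              · rintro rfl; omega
              · rintro rfl
                have := hRd v0 (by simp)
                omega
            refine ⟨v0, hv0', by rwa [hsame v0 hv0'], fun y hy hne => ?_⟩
            rw [hsame y hy]
            exact hall y (Finset.mem_sdiff.1 hy).1 hne
        have := ih _ (by omega) _ rfl hg
        omega
      · obtain ⟨R0, hR0, hR0c⟩ := Finset.exists_subset_card_eq (show 2 ≤ R.card by omega)
        have hR0A := hR0.trans hRA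
        have hd := dg_sdiff G hR0A (fun x hx => hadj x (hR0 hx))
        have hdv : dg G (A \ R0) v = 1 := by omega
        have hlow := leaf_lower2 G hv hR0A (fun x hx => hadj x (hR0 hx))
          (fun x hx y hy => hRi x (hR0 hx) y (hR0 hy)) (hone0 R0 hR0 (by omega)) hR0c
        have hc := Finset.card_sdiff_add_card_eq_card hR0A
        rw [hR0c] at hc
        have hg : Good G (A \ R0) := by
          refine ⟨fun he y hy => ?_, fun he => ?_⟩
          · by_cases hyv : y = v
            · subst hyv; left; exact hdv
            rw [hun R0 hR0 y hy hyv]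
            exact hgood.1 (by rw [← hc]; simpa [Nat.even_add] using he) y (Finset.mem_sdiff.1 hy).1
          · obtain ⟨v0, hv0A, hd0, hall⟩ := hgood.2 (by rw [← hc]; simpa [Nat.even_add] using he)
            have hv0v : v0 ≠ v := by rintro rfl; omega
            have hv0' : v0 ∈ A \ R0 := by
              refine Finset.mem_sdiff.2 ⟨hv0A, fun h => ?_⟩
              have := hRd v0 (hR0 h)
              omega
            refine ⟨v0, hv0', by rwa [hun R0 hR0 v0 hv0' hv0v], fun y hy hne => ?_⟩
            by_cases hyv : y = v
            · subst hyv; left; exact hdv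
            rw [hun R0 hR0 y hy hyv]
            exact hall y (Finset.mem_sdiff.1 hy).1 hne
        have := ih _ (by omega) _ rfl hg
        omega
      · obtain ⟨R0, hR0, hR0c⟩ := Finset.exists_subset_card_eq (show 5 ≤ R.card by omega)
        have hR0A := hR0.trans hRA
        have hd := dg_sdiff G hR0A (fun x hx => hadj x (hR0 hx))
        have hdv : dg G (A \ R0) v = 1 := by omega
        have hlow := leaf_lower5 G hv hR0A (fun x hx => hadj x (hR0 hx))
          (fun x hx y hy => hRi x (hR0 hx) y (hR0 hy)) (hone0 R0 hR0 (by omega)) hR0c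
        have hc := Finset.card_sdiff_add_card_eq_card hR0A
        rw [hR0c] at hc
        have hodd' := Nat.not_even_iff.1 hodd
        have hev : Even (A \ R0).card := by rw [Nat.even_iff]; omega
        have hg : Good G (A \ R0) := by
          refine ⟨fun he y hy => ?_, fun he => absurd hev he⟩
          by_cases hyv : y = v
          · subst hyv; left; exact hdv
          rw [hun R0 hR0 y hy hyv]
          exact hall y (Finset.mem_sdiff.1 hy).1 hyv
        have := ih _ (by omega) _ rfl hg
        omega
    · push Not at hiso
      obtain ⟨x, hx, hx0⟩ := hiso
      have hd0 := (dg_eq_zero G).2 hx0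
      have hodd : ¬ Even A.card := by
        intro he
        have := hgood.1 he x hx
        omega
      obtain ⟨v0, hv0A, _, hall⟩ := hgood.2 hodd
      have hxv : x = v0 := by
        by_contra hne
        have := hall x hx hne
        omega
      subst hxv
      have hlow := indep_add G (A := A) (I := {x}) (by simpa using hx) (by simp)
      have hc := Finset.card_sdiff_add_card_eq_card (show {x} ⊆ A by simpa using hx)
      rw [Finset.card_singleton] at hc hlow
      have hodd' := Nat.not_even_iff.1 hodd
      have hev : Even (A \ {x}).card := by rw [Nat.even_iff]; omega
      have hg : Good G (A \ {x}) := by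
        refine ⟨fun he y hy => ?_, fun he => absurd hev he⟩
        simp only [Finset.mem_sdiff, Finset.mem_singleton] at hy
        have : dg G (A \ {x}) y = dg G A y := by
          apply dg_congr
          intro z
          simp only [Finset.mem_sdiff, Finset.mem_singleton]
          constructor
          · rintro ⟨h1, h2⟩; exact ⟨h1.1, h2⟩
          · rintro ⟨h1, h2⟩
            refine ⟨⟨h1, ?_⟩, h2⟩
            rintro rfl
            exact hx0 y hy.1 h2.symm
        rw [this]
        exact hall y hy.1 hy.2
      have := ih _ (by omega) _ rfl hg
      omega

/-- Add a star with center `v` and leaves `R` to the part of `F` inside `B`. -/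
def addStar (F : SimpleGraph V) (B : Finset V) (v : V) (R : Finset V) : SimpleGraph V where
  Adj x y := (F.Adj x y ∧ x ∈ B ∧ y ∈ B) ∨ (x = v ∧ y ∈ R ∧ x ≠ y) ∨ (y = v ∧ x ∈ R ∧ x ≠ y)
  symm := ⟨fun x y h => by
    rcases h with ⟨h1, h2, h3⟩ | ⟨h1, h2, h3⟩ | ⟨h1, h2, h3⟩
    · exact Or.inl ⟨h1.symm, h3, h2⟩
    · exact Or.inr (Or.inr ⟨h1, h2, h3.symm⟩)
    · exact Or.inr (Or.inl ⟨h1, h2, h3.symm⟩)⟩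
  loopless := ⟨fun x h => by
    rcases h with ⟨h1, _⟩ | ⟨_, _, h3⟩ | ⟨_, _, h3⟩
    · exact F.loopless.irrefl _ h1
    · exact h3 rfl
    · exact h3 rfl⟩

theorem addStar_le {F T : SimpleGraph V} {B R : Finset V} {v : V} (hF : F ≤ T)
    (h : ∀ x ∈ R, T.Adj v x) : addStar F B v R ≤ T := by
  intro x y hxy
  rcases hxy with ⟨h1, _⟩ | ⟨rfl, h2, _⟩ | ⟨rfl, h2, _⟩
  · exact hF h1
  · exact h _ h2
  · exact (h _ h2).symm

theorem dg_addStar_old (F : SimpleGraph V) {A B R : Finset V} {v y : V} (hB : B ⊆ A)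
    (hdis : Disjoint B R) (hy : y ∈ B) (hyv : y ≠ v) : dg (addStar F B v R) A y = dg F B y := by
  apply dg_congr
  intro x
  have := Finset.disjoint_left.1 hdis hy
  have := @hB x
  simp only [addStar]
  tauto

theorem dg_addStar_leaf (F : SimpleGraph V) {A B R : Finset V} {v y : V} (hv : v ∈ A)
    (hvR : v ∉ R) (hdis : Disjoint B R) (hy : y ∈ R) : dg (addStar F B v R) A y = 1 := by
  have h1 := Finset.disjoint_right.1 hdis hy
  have h2 : y ≠ v := fun h => hvR (h ▸ hy)
  apply dg_leaf _ hv
  · exact Or.inr (Or.inr ⟨rfl, hy, h2⟩)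
  · intro z _ hz
    rcases hz with ⟨_, h3, _⟩ | ⟨h3, _⟩ | ⟨h3, _⟩
    · exact absurd h3 h1
    · exact absurd h3 h2
    · exact h3

theorem dg_addStar_out (F : SimpleGraph V) {A B R : Finset V} {v y : V} 
    (hyB : y ∉ B) (hyR : y ∉ R) (hyv : y ≠ v) : dg (addStar F B v R) A y = 0 := by
  rw [dg_eq_zero]
  intro z _ hz
  rcases hz with ⟨_, h3, _⟩ | ⟨h3, _⟩ | ⟨_, h3, _⟩
  · exact hyB h3
  · exact hyv h3
  · exact hyR h3

theorem dg_addStar_center (F : SimpleGraph V) {A B R : Finset V} {v : V} (hB : B ⊆ A)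
    (hR : R ⊆ A) (hvR : v ∉ R) (hdis : Disjoint B R) (hv : v ∈ B) :
    dg (addStar F B v R) A v = dg F B v + R.card := by
  have h : ∀ x ∈ R, (addStar F B v R).Adj v x := fun x hx =>
    Or.inr (Or.inl ⟨rfl, hx, fun h => hvR (h ▸ hx)⟩)
  rw [← dg_sdiff _ hR h]
  congr 1
  apply dg_congr
  intro x
  have := @hB x
  have : x ∈ B → x ∉ R := fun h => Finset.disjoint_left.1 hdis h
  simp only [addStar, Finset.mem_sdiff]
  tauto

theorem dg_addStar_center' (F : SimpleGraph V) {A B R : Finset V} {v : V} 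
    (hR : R ⊆ A) (hvR : v ∉ R) (hv : v ∉ B) :
    dg (addStar F B v R) A v = R.card := by
  have h : ∀ x ∈ R, (addStar F B v R).Adj v x := fun x hx =>
    Or.inr (Or.inl ⟨rfl, hx, fun h => hvR (h ▸ hx)⟩)
  rw [← dg_sdiff _ hR h]
  have : dg (addStar F B v R) (A \ R) v = 0 := by
    rw [dg_eq_zero]
    intro x hx hvx
    rcases hvx with ⟨_, h3, _⟩ | ⟨_, h3, _⟩ | ⟨_, h3, _⟩
    · exact hv h3
    · exact (Finset.mem_sdiff.1 hx).2 h3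
    · exact hvR h3
  omega

theorem upper (T : SimpleGraph V) (hT : T.IsAcyclic) : ∀ (n : ℕ) (A : Finset V), A.card = n →
    2 * sc T A ≤ 3 * A.card ∧ (3 * A.card / 2 ≤ sc T A → ∃ F ≤ T, Good F A) := by
  intro n
  induction n using Nat.strong_induction_on with
  | _ n ih =>
    intro A hn
    rcases A.eq_empty_or_nonempty with rfl | hne
    · refine ⟨by simp [sc_empty], fun _ => ⟨⊥, bot_le, ?_⟩⟩
      simp [Good]
    by_cases hiso : ∀ x ∈ A, ∃ y ∈ A, T.Adj x y
    · obtain ⟨v, hv, R, hRA, hRne, hvR, hadj, hleaf, hone⟩ := find_v T hT A hne hiso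
      have hRpos := Finset.card_pos.2 hRne
      set B := A \ R with hBdef
      set A' := B.erase v with hA'def
      have hvB : v ∈ B := Finset.mem_sdiff.2 ⟨hv, hvR⟩
      have hBA : B ⊆ A := Finset.sdiff_subset
      have hA'B : A' ⊆ B := Finset.erase_subset _ _
      have hA'A : A' ⊆ A := hA'B.trans hBA
      have hdisB : Disjoint B R := Finset.sdiff_disjoint
      have hdisA : Disjoint A' R := hdisB.mono_left hA'B
      have hvA' : v ∉ A' := Finset.notMem_erase _ _
      have hBR : B ∪ R = A := Finset.sdiff_union_of_subset hRA
      have hins : insert v A' = B := Finset.insert_erase hvB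
      have hcB : B.card + R.card = A.card := Finset.card_sdiff_add_card_eq_card hRA
      have hcA' : A'.card + 1 = B.card := Finset.card_erase_add_one hvB
      have hmem : ∀ y ∈ A, y = v ∨ y ∈ R ∨ y ∈ A' := by
        intro y hy
        by_cases h1 : y = v
        · exact Or.inl h1
        by_cases h2 : y ∈ R
        · exact Or.inr (Or.inl h2)
        · exact Or.inr (Or.inr (Finset.mem_erase.2 ⟨h1, Finset.mem_sdiff.2 ⟨hy, h2⟩⟩))
      have hU1 : ∀ k, 2 * (R.card + 1) ≤ (k + 1) * (k + 2) →
          sc T A ≤ sc T B + R.card + k := by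
        intro k hk
        have := U1 T v _ k B R rfl hvB hdisB (by rw [hBR]; exact hleaf) hk
        rwa [hBR] at this
      have hU2 : ∀ k, 2 * (R.card + 2) ≤ (k + 1) * (k + 2) →
          sc T A ≤ sc T A' + R.card + 1 + k := by
        intro k hk
        have := U2 T v _ k A' R rfl hvA' hvR hdisA (by rw [hins, hBR]; exact hleaf)
          (fun x hx y hy => hone x (hA'B hx) y (hA'B hy)) hk
        rwa [hins, hBR] at this
      obtain ⟨ihA1, ihA2⟩ := ih A'.card (by omega) A' rfl
      obtain ⟨ihB1, ihB2⟩ := ih B.card (by omega) B rfl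
      by_cases hr7 : 7 ≤ R.card
      · have := hU2 ((R.card - 1) / 2) (by
          obtain ⟨k, hk⟩ : ∃ k, (R.card - 1) / 2 = k := ⟨_, rfl⟩
          rw [hk]
          have h1 : 3 ≤ k := by omega
          have h2 : R.card ≤ 2 * k + 2 := by omega
          nlinarith)
        exact ⟨by omega, fun h => by omega⟩
      have hcases : R.card = 1 ∨ R.card = 2 ∨ R.card = 3 ∨ R.card = 4 ∨ R.card = 5 ∨
        R.card = 6 := by omega
      have h13 : R.card = 1 ∨ R.card = 3 → ∀ F ≤ T, Good F A' → ∃ F ≤ T, Good F A := by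
        intro hr F hFT hF
        refine ⟨addStar F A' v R, addStar_le hFT hadj, ?_⟩
        have hdv := dg_addStar_center' F (A := A) (B := A') hRA hvR hvA'
        have hpar : Even A.card ↔ Even A'.card := by
          rw [Nat.even_iff, Nat.even_iff]; omega
        refine ⟨fun he y hy => ?_, fun he => ?_⟩
        · rcases hmem y hy with rfl | h | h
          · omega
          · left; exact dg_addStar_leaf F hv hvR hdisA h
          · rw [dg_addStar_old F hA'A hdisA h (ne_of_mem_of_not_mem h hvA')]
            exact hF.1 (hpar.1 he) y h
        · obtain ⟨v0, hv0, hd0, hall⟩ := hF.2 (fun h => he (hpar.2 h))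
          refine ⟨v0, hA'A hv0, ?_, fun y hy hne => ?_⟩
          · rwa [dg_addStar_old F hA'A hdisA hv0 (ne_of_mem_of_not_mem hv0 hvA')]
          · rcases hmem y hy with rfl | h | h
            · omega
            · left; exact dg_addStar_leaf F hv hvR hdisA h
            · rw [dg_addStar_old F hA'A hdisA h (ne_of_mem_of_not_mem h hvA')]
              exact hall y h hne
      rcases hcases with hr | hr | hr | hr | hr | hr
      · have := hU2 1 (by omega)
        refine ⟨by omega, fun h => ?_⟩
        obtain ⟨F, hFT, hF⟩ := ihA2 (by omega)
        exact h13 (Or.inl hr) F hFT hF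
      · have := hU1 1 (by omega)
        refine ⟨by omega, fun h => ?_⟩
        obtain ⟨F, hFT, hF⟩ := ihB2 (by omega)
        have hFv : dg F B v ≤ 1 := dg_le_one F (fun x hx y hy h1 h2 =>
          hone x hx y hy (hFT h1) (hFT h2))
        have hpar : Even A.card ↔ Even B.card := by
          rw [Nat.even_iff, Nat.even_iff]; omega
        have hmemB : ∀ y ∈ A, y ∈ R ∨ y ∈ B := by
          intro y hy
          rcases hmem y hy with rfl | h | h
          exacts [Or.inr hvB, Or.inl h, Or.inr (hA'B h)]
        by_cases hdv1 : dg F B v = 1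
        · refine ⟨addStar F B v R, addStar_le hFT hadj, ?_⟩
          have hdv := dg_addStar_center F (A := A) (B := B) hBA hRA hvR hdisB hvB
          refine ⟨fun he y hy => ?_, fun he => ?_⟩
          · by_cases hyv : y = v
            · subst hyv; omega
            rcases hmemB y hy with h | h
            · left; exact dg_addStar_leaf F hv hvR hdisB h
            · rw [dg_addStar_old F hBA hdisB h hyv]
              exact hF.1 (hpar.1 he) y h
          · obtain ⟨v0, hv0, hd0, hall⟩ := hF.2 (fun h => he (hpar.2 h))
            have hv0v : v0 ≠ v := by rintro rfl; omega
            refine ⟨v0, hBA hv0, ?_, fun y hy hne => ?_⟩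
            · rwa [dg_addStar_old F hBA hdisB hv0 hv0v]
            · by_cases hyv : y = v
              · subst hyv; omega
              rcases hmemB y hy with h | h
              · left; exact dg_addStar_leaf F hv hvR hdisB h
              · rw [dg_addStar_old F hBA hdisB h hyv]
                exact hall y h hne
        · have he : ¬ Even A.card := by
            intro he
            have := hF.1 (hpar.1 he) v hvB
            omega
          obtain ⟨v0, hv0, hd0, hall⟩ := hF.2 (fun h => he (hpar.2 h))
          have hv0v : v = v0 := by
            by_contra hcon
            have := hall v hvB hcon
            omega
          subst hv0v
          obtain ⟨a, b, hab, rfl⟩ := Finset.card_eq_two.1 hr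
          have hsub : ({a} : Finset V) ⊆ {a, b} := by simp
          have hdis1 : Disjoint B {a} := hdisB.mono_right hsub
          have hvna : v ∉ ({a} : Finset V) := fun h => hvR (hsub h)
          have hdv := dg_addStar_center F (A := A) (B := B) hBA (hsub.trans hRA) hvna hdis1 hvB
          rw [Finset.card_singleton] at hdv
          have hb : b ∈ ({a, b} : Finset V) := by simp
          refine ⟨addStar F B v {a}, addStar_le hFT (fun x hx => hadj x (hsub hx)),
            fun h => absurd h he, fun _ => ⟨b, hRA hb, Or.inl ?_, fun y hy hyb => ?_⟩⟩
          · exact dg_addStar_out F (Finset.disjoint_right.1 hdisB hb) (by simpa using hab.symm)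
              (fun h => hvR (h ▸ hb))
          · by_cases hyv : y = v
            · subst hyv; omega
            rcases hmemB y hy with h | h
            · left
              apply dg_addStar_leaf F hv hvna hdis1
              simp only [Finset.mem_insert, Finset.mem_singleton] at h ⊢
              tauto
            · rw [dg_addStar_old F hBA hdis1 h hyv]
              exact hall y h hyv
      · have := hU2 2 (by omega)
        refine ⟨by omega, fun h => ?_⟩
        obtain ⟨F, hFT, hF⟩ := ihA2 (by omega)
        exact h13 (Or.inr hr) F hFT hF
      · have := hU2 2 (by omega)
        refine ⟨by omega, fun h => ?_⟩
        obtain ⟨F, hFT, hF⟩ := ihA2 (by omega)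
        have heA' : Even A'.card := by rw [Nat.even_iff]; omega
        have he : ¬ Even A.card := by rw [Nat.even_iff] at heA' ⊢; omega
        obtain ⟨b, hb⟩ := hRne
        have hsub : R.erase b ⊆ R := Finset.erase_subset _ _
        have hc3 := Finset.card_erase_add_one hb
        have hdis1 : Disjoint A' (R.erase b) := hdisA.mono_right hsub
        have hvna : v ∉ R.erase b := fun h => hvR (hsub h)
        have hdv := dg_addStar_center' F (A := A) (B := A') (hsub.trans hRA) hvna hvA'
        refine ⟨addStar F A' v (R.erase b), addStar_le hFT (fun x hx => hadj x (hsub hx)),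
            fun h => absurd h he, fun _ => ⟨b, hRA hb, Or.inl ?_, fun y hy hyb => ?_⟩⟩
        · exact dg_addStar_out F (Finset.disjoint_right.1 hdisA hb) (by simp)
              (fun h => hvR (h ▸ hb))
        · rcases hmem y hy with rfl | h | h
          · omega
          · left
            exact dg_addStar_leaf F hv hvna hdis1 (Finset.mem_erase.2 ⟨hyb, h⟩)
          · rw [dg_addStar_old F hA'A hdis1 h (ne_of_mem_of_not_mem h hvA')]
            exact hF.1 heA' y h
      · have := hU1 2 (by omega)
        refine ⟨by omega, fun h => ?_⟩
        obtain ⟨F, hFT, hF⟩ := ihB2 (by omega)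
        have hFv : dg F B v ≤ 1 := dg_le_one F (fun x hx y hy h1 h2 =>
          hone x hx y hy (hFT h1) (hFT h2))
        have heB : Even B.card := by rw [Nat.even_iff]; omega
        have he : ¬ Even A.card := by rw [Nat.even_iff] at heB ⊢; omega
        have hdv := dg_addStar_center F (A := A) (B := B) hBA hRA hvR hdisB hvB
        have hv1 := hF.1 heB v hvB
        refine ⟨addStar F B v R, addStar_le hFT hadj,
            fun h => absurd h he, fun _ => ⟨v, hv, by omega, fun y hy hyv => ?_⟩⟩
        rcases hmem y hy with h | h | h
        · exact absurd h hyv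
        · left; exact dg_addStar_leaf F hv hvR hdisB h
        · rw [dg_addStar_old F hBA hdisB (hA'B h) hyv]
          exact hF.1 heB y (hA'B h)
      · have := hU2 3 (by omega)
        refine ⟨by omega, fun h => ?_⟩
        obtain ⟨F, hFT, hF⟩ := ihA2 (by omega)
        have heA' : Even A'.card := by rw [Nat.even_iff]; omega
        have he : ¬ Even A.card := by rw [Nat.even_iff] at heA' ⊢; omega
        have hdv := dg_addStar_center' F (A := A) (B := A') hRA hvR hvA'
        refine ⟨addStar F A' v R, addStar_le hFT hadj,
            fun h => absurd h he, fun _ => ⟨v, hv, by omega, fun y hy hyv => ?_⟩⟩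
        rcases hmem y hy with h | h | h
        · exact absurd h hyv
        · left; exact dg_addStar_leaf F hv hvR hdisA h
        · rw [dg_addStar_old F hA'A hdisA h hyv]
          exact hF.1 heA' y h
    · push Not at hiso
      obtain ⟨x, hx, hx0⟩ := hiso
      have hc := Finset.card_erase_add_one hx
      have hle := iso T _ (A.erase x) {x} rfl (by simp) (by
        intro a ha y hy
        rw [Finset.mem_singleton.1 ha]
        apply hx0
        simp only [Finset.mem_union, Finset.mem_erase, Finset.mem_singleton] at hy
        rcases hy with h | rfl
        exacts [h.2, hx])
      have hE : A.erase x ∪ {x} = A := by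
        rw [Finset.union_comm, ← Finset.insert_eq, Finset.insert_erase hx]
      rw [hE, Finset.card_singleton] at hle
      obtain ⟨ih1, ih2⟩ := ih (A.erase x).card (by omega) _ rfl
      refine ⟨by omega, fun h => ?_⟩
      obtain ⟨F, hFT, hF⟩ := ih2 (by omega)
      have heA' : Even (A.erase x).card := by rw [Nat.even_iff]; omega
      have he : ¬ Even A.card := by rw [Nat.even_iff] at heA' ⊢; omega
      refine ⟨addStar F (A.erase x) x ∅, addStar_le hFT (by simp), fun h => absurd h he,
        fun _ => ⟨x, hx, Or.inl ?_, fun y hy hyx => ?_⟩⟩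
      · rw [dg_addStar_center' F (by simp) (by simp) (by simp)]; simp
      · have hy' : y ∈ A.erase x := Finset.mem_erase.2 ⟨hyx, hy⟩
        rw [dg_addStar_old F (Finset.erase_subset _ _) (by simp) hy' hyx]
        exact hF.1 heA' y hy'

theorem dg_univ [Fintype V] (F : SimpleGraph V) (v : V) :
    dg F Finset.univ v = (F.neighborSet v).ncard := by
  classical
  unfold dg
  rw [← Set.ncard_coe_finset]
  congr 1
  ext x
  simp

end SlowC

/-- A forest `T` on `n` vertices satisfies `𝓈(T) = ⌊3n/2⌋` iff `T` contains a
spanning forest in which every vertex has degree `1` or `3`, except for one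
vertex of degree `0` or `6` when `n` is odd. -/
theorem sumColorCost_forest_eq_iff {V : Type*} [Fintype V] [DecidableEq V]
    (T : SimpleGraph V) (hT : T.IsAcyclic) :
    T.sumColorCost = 3 * Fintype.card V / 2 ↔
      ∃ F : SimpleGraph V, F ≤ T ∧ F.IsAcyclic ∧
        (Even (Fintype.card V) →
          ∀ v, (F.neighborSet v).ncard = 1 ∨ (F.neighborSet v).ncard = 3) ∧
        (¬ Even (Fintype.card V) →
          ∃ v₀, ((F.neighborSet v₀).ncard = 0 ∨ (F.neighborSet v₀).ncard = 6) ∧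
            ∀ v, v ≠ v₀ →
              (F.neighborSet v).ncard = 1 ∨ (F.neighborSet v).ncard = 3) := by

  have hcost : T.sumColorCost = SlowC.sc T Finset.univ := by
    unfold SimpleGraph.sumColorCost
    exact SlowC.fuel T _ _ (by simp)
  obtain ⟨hup, hex⟩ := SlowC.upper T hT _ Finset.univ rfl
  rw [Finset.card_univ] at hup hex
  rw [hcost]
  constructor
  · intro h
    obtain ⟨F, hFT, hF⟩ := hex (by omega)
    refine ⟨F, hFT, hT.anti hFT, fun he v => ?_, fun he => ?_⟩
    · rw [← SlowC.dg_univ]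
      exact hF.1 (by rwa [Finset.card_univ]) v (Finset.mem_univ v)
    · obtain ⟨v₀, _, hd, hall⟩ := hF.2 (by rwa [Finset.card_univ])
      refine ⟨v₀, by rwa [← SlowC.dg_univ], fun v hv => ?_⟩
      rw [← SlowC.dg_univ]
      exact hall v (Finset.mem_univ v) hv
  · rintro ⟨F, hFT, hFa, h1, h2⟩
    have hg : SlowC.Good F Finset.univ := by
      refine ⟨fun he v _ => ?_, fun he => ?_⟩
      · rw [SlowC.dg_univ]
        exact h1 (by rwa [Finset.card_univ] at he) v
      · obtain ⟨v₀, hd, hall⟩ := h2 (by rwa [Finset.card_univ] at he)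
        refine ⟨v₀, Finset.mem_univ _, by rwa [SlowC.dg_univ], fun v _ hv => ?_⟩
        rw [SlowC.dg_univ]
        exact hall v hv
    have hlow := SlowC.lower F hFa _ Finset.univ rfl hg
    rw [Finset.card_univ] at hlow
    have hmono := SlowC.edge_mono hFT _ Finset.univ rfl
    omega
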